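/- Suppose L_S is twice continuously differentiable, its gradient is L-Lipschitz on W × Φ with L > 0, (w,φ) ↦ ∇²_w L_S(w,φ) is ρ-Lipschitz in operator norm, and α > 0. Then for every N ≥ 1 and all (w₁,φ₁), (w₂,φ₂) ∈ W × Φ (in operator norm, products ordered with the m = 0 factor leftmost): ‖∏_{m=0}^{N−1}(I − α∇²_w L_S(w_m(w₁,φ₁),φ₁)) − ∏_{m=0}^{N−1}(I − α∇²_w L_S(w_m(w₂,φ₂),φ₂))‖ ≤ (2ρ/L)(1 + αL)^{2N−1} (‖w₁ − w₂‖ + ‖φ₁ − φ₂‖). -/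

import Mathlib

noncomputable section

open scoped RealInnerProductSpace

abbrev Wsp (p : ℕ) := EuclideanSpace ℝ (Fin p)

/-- Partial gradient in the first block of variables. -/
def gradW {p q : ℕ} (f : Wsp p × Wsp q → ℝ) (w : Wsp p) (φ : Wsp q) : Wsp p :=
  gradient (fun u => f (u, φ)) w

/-- Partial gradient in the second block of variables. -/
def gradPhi {p q : ℕ} (f : Wsp p × Wsp q → ℝ) (w : Wsp p) (φ : Wsp q) : Wsp q :=
  gradient (fun ψ => f (w, ψ)) φ

/-- Inner-loop gradient descent iterates. -/
def innerIter {p q : ℕ} (f : Wsp p × Wsp q → ℝ) (α : ℝ) : ℕ → Wsp p → Wsp q → Wsp p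
  | 0, w, _ => w
  | (m+1), w, φ => innerIter f α m w φ - α • gradW f (innerIter f α m w φ) φ

/-- Hessian in `w` of `f(·,φ)` at `w`, as a continuous linear map. -/
def hessW {p q : ℕ} (f : Wsp p × Wsp q → ℝ) (w : Wsp p) (φ : Wsp q) : Wsp p →L[ℝ] Wsp p :=
  fderiv ℝ (fun u => gradW f u φ) w

/-- Mixed second derivative `∇_φ∇_w f (w,φ)`, viewed as a linear map `W → Φ`. -/
def crossD {p q : ℕ} (f : Wsp p × Wsp q → ℝ) (w : Wsp p) (φ : Wsp q) : Wsp p →L[ℝ] Wsp q :=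
  ContinuousLinearMap.adjoint (fderiv ℝ (fun ψ => gradW f w ψ) φ)

/-- Ordered product `A a * A (a+1) * ⋯ * A (b-1)` (factor `A a` leftmost, i.e. applied last). -/
def prodIco {p : ℕ} (A : ℕ → (Wsp p →L[ℝ] Wsp p)) (a b : ℕ) : Wsp p →L[ℝ] Wsp p :=
  ((List.range (b - a)).map (fun k => A (a + k))).prod

/-- `f(·,φ)` is `μc`-strongly convex in `w`, for every `φ`. -/
def StrongConvexIn {p q : ℕ} (μc : ℝ) (f : Wsp p × Wsp q → ℝ) : Prop :=
  ∀ (w w' : Wsp p) (φ : Wsp q),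
    f (w', φ) ≥ f (w, φ) + ⟪w' - w, gradW f w φ⟫ + μc / 2 * ‖w - w'‖ ^ 2

/-- The (full) gradient of `f` is `L`-Lipschitz on `W × Φ` (Euclidean norms). -/
def GradLip {p q : ℕ} (L : ℝ) (f : Wsp p × Wsp q → ℝ) : Prop :=
  ∀ (w₁ w₂ : Wsp p) (φ₁ φ₂ : Wsp q),
    Real.sqrt (‖gradW f w₁ φ₁ - gradW f w₂ φ₂‖ ^ 2 + ‖gradPhi f w₁ φ₁ - gradPhi f w₂ φ₂‖ ^ 2)
      ≤ L * Real.sqrt (‖w₁ - w₂‖ ^ 2 + ‖φ₁ - φ₂‖ ^ 2)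

/-- `f` is `M`-Lipschitz on `W × Φ` (Euclidean norms). -/
def FunLip {p q : ℕ} (M : ℝ) (f : Wsp p × Wsp q → ℝ) : Prop :=
  ∀ (w₁ w₂ : Wsp p) (φ₁ φ₂ : Wsp q),
    |f (w₁, φ₁) - f (w₂, φ₂)| ≤ M * Real.sqrt (‖w₁ - w₂‖ ^ 2 + ‖φ₁ - φ₂‖ ^ 2)

/-- `(w,φ) ↦ ∇²_w f(w,φ)` is `ρ`-Lipschitz in operator norm. -/
def HessLip {p q : ℕ} (ρ : ℝ) (f : Wsp p × Wsp q → ℝ) : Prop :=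
  ∀ (w₁ w₂ : Wsp p) (φ₁ φ₂ : Wsp q),
    ‖hessW f w₁ φ₁ - hessW f w₂ φ₂‖ ≤ ρ * Real.sqrt (‖w₁ - w₂‖ ^ 2 + ‖φ₁ - φ₂‖ ^ 2)

/-- `(w,φ) ↦ ∇_φ∇_w f(w,φ)` is `τ`-Lipschitz in operator norm. -/
def CrossLip {p q : ℕ} (τ : ℝ) (f : Wsp p × Wsp q → ℝ) : Prop :=
  ∀ (w₁ w₂ : Wsp p) (φ₁ φ₂ : Wsp q),
    ‖crossD f w₁ φ₁ - crossD f w₂ φ₂‖ ≤ τ * Real.sqrt (‖w₁ - w₂‖ ^ 2 + ‖φ₁ - φ₂‖ ^ 2)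

theorem aux_sqrt_le (a b : ℝ) (ha : 0 ≤ a) (hb : 0 ≤ b) : Real.sqrt (a ^ 2 + b ^ 2) ≤ a + b := by
  rw [Real.sqrt_le_left (by positivity)]
  nlinarith [mul_nonneg ha hb]

theorem aux_gradW {p q : ℕ} {LS : Wsp p × Wsp q → ℝ} {L : ℝ} (hLip : GradLip L LS)
    (w₁ w₂ : Wsp p) (φ₁ φ₂ : Wsp q) :
    ‖gradW LS w₁ φ₁ - gradW LS w₂ φ₂‖ ≤ L * Real.sqrt (‖w₁ - w₂‖ ^ 2 + ‖φ₁ - φ₂‖ ^ 2) := by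
  refine le_trans ?_ (hLip w₁ w₂ φ₁ φ₂)
  apply Real.le_sqrt_of_sq_le
  nlinarith [sq_nonneg ‖gradPhi LS w₁ φ₁ - gradPhi LS w₂ φ₂‖]

theorem aux_hess {p q : ℕ} {LS : Wsp p × Wsp q → ℝ} {L : ℝ} (hLip : GradLip L LS) (hL : 0 < L)
    (w : Wsp p) (φ : Wsp q) : ‖hessW LS w φ‖ ≤ L := by
  have h : LipschitzWith L.toNNReal (fun u => gradW LS u φ) := by
    apply LipschitzWith.of_dist_le_mul
    intro x y
    rw [dist_eq_norm, dist_eq_norm, Real.coe_toNNReal _ hL.le]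
    have := aux_gradW hLip x y φ φ
    simpa [Real.sqrt_sq (norm_nonneg _)] using this
  have := norm_fderiv_le_of_lipschitz ℝ h (x₀ := w)
  rwa [Real.coe_toNNReal _ hL.le] at this

theorem aux_iter {p q : ℕ} {LS : Wsp p × Wsp q → ℝ} {L α : ℝ} (hLip : GradLip L LS) (hL : 0 < L)
    (hα : 0 < α) (w₁ w₂ : Wsp p) (φ₁ φ₂ : Wsp q) (m : ℕ) :
    ‖innerIter LS α m w₁ φ₁ - innerIter LS α m w₂ φ₂‖ + ‖φ₁ - φ₂‖
      ≤ (1 + α * L) ^ m * (‖w₁ - w₂‖ + ‖φ₁ - φ₂‖) := by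
  induction m with
  | zero => simp [innerIter]
  | succ m ih =>
    simp only [innerIter]
    set u := innerIter LS α m w₁ φ₁
    set v := innerIter LS α m w₂ φ₂
    have h1 := aux_gradW hLip u v φ₁ φ₂
    have h2 := aux_sqrt_le ‖u - v‖ ‖φ₁ - φ₂‖ (norm_nonneg _) (norm_nonneg _)
    have h3 : ‖gradW LS u φ₁ - gradW LS v φ₂‖ ≤ L * (‖u - v‖ + ‖φ₁ - φ₂‖) :=
      h1.trans (mul_le_mul_of_nonneg_left h2 hL.le)
    have h4 : ‖(u - α • gradW LS u φ₁) - (v - α • gradW LS v φ₂)‖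
        ≤ ‖u - v‖ + α * ‖gradW LS u φ₁ - gradW LS v φ₂‖ := by
      have e : (u - α • gradW LS u φ₁) - (v - α • gradW LS v φ₂)
          = (u - v) - α • (gradW LS u φ₁ - gradW LS v φ₂) := by
        rw [smul_sub]; abel
      rw [e]
      refine (norm_sub_le _ _).trans ?_
      rw [norm_smul, Real.norm_of_nonneg hα.le]
    have h5 := mul_le_mul_of_nonneg_left h3 hα.le
    have h6 := mul_le_mul_of_nonneg_left ih (by positivity : 0 ≤ 1 + α * L)
    rw [pow_succ]
    nlinarith

theorem aux_prod_succ {p : ℕ} (A : ℕ → (Wsp p →L[ℝ] Wsp p)) (N : ℕ) :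
    prodIco A 0 (N + 1) = prodIco A 0 N * A N := by
  simp [prodIco, List.range_succ]

theorem aux_prod_norm {p : ℕ} (A : ℕ → (Wsp p →L[ℝ] Wsp p)) (b : ℝ) (hA : ∀ m, ‖A m‖ ≤ b)
    (N : ℕ) : ‖prodIco A 0 N‖ ≤ b ^ N := by
  have hb : 0 ≤ b := (norm_nonneg _).trans (hA 0)
  induction N with
  | zero =>
    simp only [prodIco, Nat.sub_self, List.range_zero, List.map_nil, List.prod_nil, pow_zero]
    exact ContinuousLinearMap.norm_id_le (𝕜 := ℝ) (E := Wsp p)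
  | succ N ih =>
    rw [aux_prod_succ, pow_succ]
    exact (norm_mul_le _ _).trans (mul_le_mul ih (hA N) (norm_nonneg _) (by positivity))

theorem aux_prod_diff {p : ℕ} (A B : ℕ → (Wsp p →L[ℝ] Wsp p)) (b c : ℝ)
    (hA : ∀ m, ‖A m‖ ≤ b) (hB : ∀ m, ‖B m‖ ≤ b) (hb1 : 1 ≤ b)
    (hAB : ∀ m, ‖A m - B m‖ ≤ c * b ^ m) (N : ℕ) :
    ‖prodIco A 0 N - prodIco B 0 N‖ * b * (b - 1) ≤ c * b ^ N * (b ^ N - 1) := by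
  have hb : 0 ≤ b := by linarith
  induction N with
  | zero => simp [prodIco]
  | succ N ih =>
    have e : prodIco A 0 (N + 1) - prodIco B 0 (N + 1)
        = (prodIco A 0 N - prodIco B 0 N) * A N + prodIco B 0 N * (A N - B N) := by
      rw [aux_prod_succ, aux_prod_succ, sub_mul, mul_sub]; abel
    have h1 : ‖prodIco A 0 (N + 1) - prodIco B 0 (N + 1)‖
        ≤ ‖prodIco A 0 N - prodIco B 0 N‖ * b + b ^ N * (c * b ^ N) := by
      rw [e]
      refine (norm_add_le _ _).trans (add_le_add ?_ ?_)
      · exact (norm_mul_le _ _).trans (mul_le_mul_of_nonneg_left (hA N) (norm_nonneg _))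
      · exact (norm_mul_le _ _).trans
          (mul_le_mul (aux_prod_norm B b hB N) (hAB N) (norm_nonneg _) (by positivity))
    have h2 := mul_le_mul_of_nonneg_right h1 (mul_nonneg hb (sub_nonneg.2 hb1))
    have h3 := mul_le_mul_of_nonneg_left ih hb
    rw [pow_succ]
    nlinarith

/-- Lipschitz bound on the ordered product
`∏_{m=0}^{N-1}(I - α∇²_w L_S(w_m,φ))` in the nonconvex case. -/
theorem anil_product_lipschitz_nonconvex (p q : ℕ) (LS : Wsp p × Wsp q → ℝ)
    (hLS : ContDiff ℝ 2 LS) (L ρ α : ℝ)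
    (hLip : GradLip L LS) (hL : 0 < L) (hHess : HessLip ρ LS) (hα : 0 < α) :
    ∀ (N : ℕ), 1 ≤ N → ∀ (w₁ w₂ : Wsp p) (φ₁ φ₂ : Wsp q),
      ‖prodIco (fun m => 1 - α • hessW LS (innerIter LS α m w₁ φ₁) φ₁) 0 N
          - prodIco (fun m => 1 - α • hessW LS (innerIter LS α m w₂ φ₂) φ₂) 0 N‖
        ≤ (2 * ρ / L) * (1 + α * L) ^ (2 * N - 1) * (‖w₁ - w₂‖ + ‖φ₁ - φ₂‖) := by
  intro N hN w₁ w₂ φ₁ φ₂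
  by_cases hρ : 0 ≤ ρ
  · set D := ‖w₁ - w₂‖ + ‖φ₁ - φ₂‖ with hD
    have hD0 : 0 ≤ D := by positivity
    set b := 1 + α * L with hb
    have hαL : 0 < α * L := mul_pos hα hL
    have hfac : ∀ w φ, ‖(1 : Wsp p →L[ℝ] Wsp p) - α • hessW LS w φ‖ ≤ b := by
      intro w φ
      refine (norm_sub_le _ _).trans (add_le_add ?_ ?_)
      · exact ContinuousLinearMap.norm_id_le (𝕜 := ℝ) (E := Wsp p)
      · rw [norm_smul, Real.norm_of_nonneg hα.le]
        exact mul_le_mul_of_nonneg_left (aux_hess hLip hL w φ) hα.le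
    have key := aux_prod_diff
      (fun m => 1 - α • hessW LS (innerIter LS α m w₁ φ₁) φ₁)
      (fun m => 1 - α • hessW LS (innerIter LS α m w₂ φ₂) φ₂) b (α * ρ * D)
      (fun m => hfac _ _) (fun m => hfac _ _) (by linarith) (by
        intro m
        have e : ((1 : Wsp p →L[ℝ] Wsp p) - α • hessW LS (innerIter LS α m w₁ φ₁) φ₁)
            - (1 - α • hessW LS (innerIter LS α m w₂ φ₂) φ₂)
            = -(α • (hessW LS (innerIter LS α m w₁ φ₁) φ₁
              - hessW LS (innerIter LS α m w₂ φ₂) φ₂)) := by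
          rw [smul_sub]; abel
        simp only [e]
        rw [norm_neg, norm_smul, Real.norm_of_nonneg hα.le]
        have h1 := hHess (innerIter LS α m w₁ φ₁) (innerIter LS α m w₂ φ₂) φ₁ φ₂
        have h2 := (aux_sqrt_le _ _ (norm_nonneg _) (norm_nonneg _)).trans
          (aux_iter hLip hL hα w₁ w₂ φ₁ φ₂ m)
        have h3 := mul_le_mul_of_nonneg_left (h1.trans (mul_le_mul_of_nonneg_left h2 hρ)) hα.le
        refine h3.trans (le_of_eq ?_)
        rw [hD, hb]; ring) N
    set E := ‖prodIco (fun m => 1 - α • hessW LS (innerIter LS α m w₁ φ₁) φ₁) 0 N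
      - prodIco (fun m => 1 - α • hessW LS (innerIter LS α m w₂ φ₂) φ₂) 0 N‖
    have hb0 : 0 < b := by linarith
    obtain ⟨k, rfl⟩ : ∃ k, N = k + 1 := ⟨N - 1, by omega⟩
    have hk : 2 * (k + 1) - 1 = 2 * k + 1 := by omega
    rw [hk]
    have hb1 : b - 1 = α * L := by rw [hb]; ring
    rw [hb1] at key
    have h1 : E * (b * (α * L)) ≤ (ρ / L * b ^ (2 * k + 1) * D) * (b * (α * L)) := by
      have h2 : (ρ / L * b ^ (2 * k + 1) * D) * (b * (α * L))
          = α * ρ * D * b ^ (k + 1) * b ^ (k + 1) := by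
        field_simp
        ring
      have h3 : 0 ≤ α * ρ * D * b ^ (k + 1) := by positivity
      rw [h2]
      nlinarith
    have h4 := le_of_mul_le_mul_right h1 (by positivity)
    have h5 : 0 ≤ ρ / L * b ^ (2 * k + 1) * D := by positivity
    have h6 : 2 * ρ / L * b ^ (2 * k + 1) * D = 2 * (ρ / L * b ^ (2 * k + 1) * D) := by ring
    rw [h6]
    linarith
  · have h := (norm_nonneg _).trans (hHess w₁ w₂ φ₁ φ₂)
    have hs : Real.sqrt (‖w₁ - w₂‖ ^ 2 + ‖φ₁ - φ₂‖ ^ 2) ≤ 0 := by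
      by_contra hc
      push Not at hc hρ
      nlinarith
    have hs' := Real.sqrt_eq_zero'.1 (le_antisymm hs (Real.sqrt_nonneg _))
    have hw : ‖w₁ - w₂‖ = 0 := by
      have : ‖w₁ - w₂‖ ^ 2 = 0 := by nlinarith [sq_nonneg ‖w₁ - w₂‖, sq_nonneg ‖φ₁ - φ₂‖]
      simpa using this
    have hf : ‖φ₁ - φ₂‖ = 0 := by
      have : ‖φ₁ - φ₂‖ ^ 2 = 0 := by nlinarith [sq_nonneg ‖w₁ - w₂‖, sq_nonneg ‖φ₁ - φ₂‖]
      simpa using this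
    obtain rfl := sub_eq_zero.1 (norm_eq_zero.1 hw)
    obtain rfl := sub_eq_zero.1 (norm_eq_zero.1 hf)
    simp
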